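/- For every prime p there exists a constant C = C(p) > 0 such that for every α ∈ (0,1]: if n ≥ exp(exp(exp(C/α^C))) and f : 𝔽_p^n → {0,1} has average E_x[f(x)] ≥ α over uniform x ∈ 𝔽_p^n, then f is not restricted 3-AP free; that is, there exist x ∈ 𝔽_p^n and a ∈ 𝔽_p^n with every coordinate of a in {0,1,2} ⊆ 𝔽_p and a ≠ 0 such that f(x) = f(x+a) = f(x+2a) = 1. -/

import Mathlib

open Finset
open scoped BigOperators

section Expect
variable {X Y G : Type*} [Fintype X] [Fintype Y] [AddCommGroup G] [Fintype G]

lemma sq_expect_le_expect_sq (F : X → ℝ) : (𝔼 x, F x) ^ 2 ≤ 𝔼 x, F x ^ 2 := by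
  rcases isEmpty_or_nonempty X with h | h
  · simp
  · simpa using expect_mul_sq_le_sq_mul_sq univ F 1

lemma sq_expect_mul_le {g : X → ℝ} (hg : ∀ x, |g x| ≤ 1) (F : X → ℝ) :
    (𝔼 x, g x * F x) ^ 2 ≤ 𝔼 x, F x ^ 2 := by
  refine (sq_expect_le_expect_sq _).trans (expect_le_expect fun x _ => ?_)
  rw [mul_pow]
  exact mul_le_of_le_one_left (sq_nonneg _) ((sq_le_one_iff_abs_le_one _).2 (hg x))

lemma expect_add_right_shift {M : Type*} [AddCommMonoid M] [Module ℚ≥0 M] (F : G → M) (c : G) :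
    𝔼 u, F (u + c) = 𝔼 u, F u :=
  Fintype.expect_equiv (Equiv.addRight c) _ _ fun _ => rfl

lemma sq_expect_eq (F : X → ℝ) : (𝔼 x, F x) ^ 2 = 𝔼 x, 𝔼 y, F x * F y := by
  rw [sq, expect_mul_expect]

lemma expect_prod_type {M : Type*} [AddCommMonoid M] [Module ℚ≥0 M] (F : X × Y → M) :
    𝔼 z, F z = 𝔼 x, 𝔼 y, F (x, y) := by
  rw [← univ_product_univ, expect_product]

lemma abs_expect_le_of_le {F : X → ℝ} [Nonempty X] {B : ℝ} (h : ∀ x, |F x| ≤ B) :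
    |𝔼 x, F x| ≤ B :=
  (abs_expect_le _ _).trans (expect_le univ_nonempty fun x _ => h x)

/-- The average of `f` over the parallelograms with sides in the ranges of `a` and `b`. -/
noncomputable def boxForm (f : G → ℝ) (a : X → G) (b : Y → G) : ℝ :=
  𝔼 x, 𝔼 y, 𝔼 u, f u * f (u + a x) * f (u + b y) * f (u + a x + b y)

lemma boxForm_comm (f : G → ℝ) (a : X → G) (b : Y → G) : boxForm f a b = boxForm f b a := by
  unfold boxForm
  rw [expect_comm]
  refine expect_congr rfl fun y _ => expect_congr rfl fun x _ => expect_congr rfl fun u _ => ?_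
  rw [add_right_comm u (a x)]
  ring

lemma boxForm_sq_le {f : G → ℝ} (hf : ∀ u, |f u| ≤ 1) (a : X → G) (b : Y → G) :
    boxForm f a b ^ 2 ≤ boxForm f a (fun z : Y × Y => b z.2 - b z.1) := by
  have h1 : boxForm f a b = 𝔼 z : X × G, (f z.2 * f (z.2 + a z.1)) *
      𝔼 y, f (z.2 + b y) * f (z.2 + a z.1 + b y) := by
    rw [expect_prod_type]
    refine expect_congr rfl fun x _ => ?_
    rw [expect_comm]
    refine expect_congr rfl fun u _ => ?_
    rw [mul_expect]
    refine expect_congr rfl fun y _ => ?_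
    ring
  rw [h1]
  refine (sq_expect_mul_le (fun z => ?_) _).trans_eq ?_
  · rw [abs_mul]
    exact mul_le_one₀ (hf _) (abs_nonneg _) (hf _)
  · unfold boxForm
    rw [expect_prod_type]
    refine expect_congr rfl fun x _ => ?_
    simp only [sq_expect_eq]
    rw [expect_comm, expect_prod_type]
    refine expect_congr rfl fun y _ => ?_
    rw [expect_comm]
    refine expect_congr rfl fun y' _ => ?_
    symm
    rw [← expect_add_right_shift _ (b y)]
    refine expect_congr rfl fun u _ => ?_
    rw [show u + b y + a x = u + a x + b y by abel,
      show u + b y + (b y' - b y) = u + b y' by abel,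
      show u + a x + b y + (b y' - b y) = u + a x + b y' by abel]
    ring

/-- The average of `f x * g (x + d) * h (x + 2 d)` over differences `d` in a sumset. -/
noncomputable def apForm (f g h : G → ℝ) (a : X → G) (b : Y → G) : ℝ :=
  𝔼 s, 𝔼 t, 𝔼 x, f x * g (x + (a s + b t)) * h (x + 2 • (a s + b t))

lemma apForm_pow_four_le {f g h : G → ℝ} (hg : ∀ u, |g u| ≤ 1)
    (hh : ∀ u, |h u| ≤ 1) (a : X → G) (b : Y → G) :
    apForm f g h a b ^ 4 ≤
      boxForm f (fun z : X × X => 2 • (a z.1 - a z.2)) (fun z : Y × Y => b z.1 - b z.2) := by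
  have h1 : apForm f g h a b = 𝔼 z : G × Y, h z.1 *
      𝔼 s, f (z.1 - 2 • (a s + b z.2)) * g (z.1 - (a s + b z.2)) := by
    rw [expect_prod_type, expect_comm]
    unfold apForm
    rw [expect_comm]
    refine expect_congr rfl fun t _ => ?_
    simp only [mul_expect]
    rw [expect_comm (s := (univ : Finset G))]
    refine expect_congr rfl fun s _ => ?_
    rw [← expect_add_right_shift _ (- (2 • (a s + b t)))]
    refine expect_congr rfl fun u _ => ?_
    rw [neg_add_cancel_right, ← sub_eq_add_neg,
      show u - 2 • (a s + b t) + (a s + b t) = u - (a s + b t) by abel]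
    ring
  have h2 : apForm f g h a b ^ 2 ≤ 𝔼 z : X × X × G, (g z.2.2 * g (z.2.2 + a z.1 - a z.2.1)) *
      𝔼 t, f (z.2.2 - a z.1 - b t) * f (z.2.2 + a z.1 - 2 • a z.2.1 - b t) := by
    rw [h1]
    refine (sq_expect_mul_le (fun z => hh _) _).trans_eq ?_
    simp only [expect_prod_type, sq_expect_eq, mul_expect]
    rw [expect_comm]
    conv_lhs => enter [2, t]; rw [expect_comm]; enter [2, s]; rw [expect_comm]
    conv_rhs => enter [2, s, 2, s']; rw [expect_comm]
    conv_rhs => enter [2, s]; rw [expect_comm]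
    rw [expect_comm]
    refine expect_congr rfl fun s _ => expect_congr rfl fun t _ => expect_congr rfl fun s' _ => ?_
    rw [← expect_add_right_shift _ (a s + b t)]
    refine expect_congr rfl fun u _ => ?_
    rw [show u + (a s + b t) - 2 • (a s + b t) = u - a s - b t by abel,
      show u + (a s + b t) - (a s + b t) = u by abel,
      show u + (a s + b t) - 2 • (a s' + b t) = u + a s - 2 • a s' - b t by abel,
      show u + (a s + b t) - (a s' + b t) = u + a s - a s' by abel]
    ring
  calc apForm f g h a b ^ 4 = (apForm f g h a b ^ 2) ^ 2 := by ring
    _ ≤ (𝔼 z : X × X × G, (g z.2.2 * g (z.2.2 + a z.1 - a z.2.1)) *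
      𝔼 t, f (z.2.2 - a z.1 - b t) * f (z.2.2 + a z.1 - 2 • a z.2.1 - b t)) ^ 2 :=
        pow_le_pow_left₀ (sq_nonneg _) h2 2
    _ ≤ _ := sq_expect_mul_le (fun z => by
        rw [abs_mul]; exact mul_le_one₀ (hg _) (abs_nonneg _) (hg _)) _
    _ = _ := by
      unfold boxForm
      simp only [expect_prod_type, sq_expect_eq]
      refine expect_congr rfl fun s _ => expect_congr rfl fun s' _ => ?_
      rw [expect_comm]
      refine expect_congr rfl fun t _ => ?_
      rw [expect_comm]
      refine expect_congr rfl fun t' _ => ?_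
      rw [← expect_add_right_shift _ (a s + b t)]
      refine expect_congr rfl fun u _ => ?_
      rw [show u + (a s + b t) - a s - b t = u by abel,
        show u + (a s + b t) + a s - 2 • a s' - b t = u + 2 • (a s - a s') by abel,
        show u + (a s + b t) - a s - b t' = u + (b t - b t') by abel,
        show u + (a s + b t) + a s - 2 • a s' - b t' = u + 2 • (a s - a s') + (b t - b t') by abel]
      ring
end Expect

lemma boxForm_comp_equiv {X Y Z G : Type*} [Fintype X] [Fintype Y] [Fintype Z] [AddCommGroup G]
    [Fintype G] (f : G → ℝ) (a : X → G) (b : Y → G) (e : Z ≃ Y) :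
    boxForm f a (fun z => b (e z)) = boxForm f a b :=
  expect_congr rfl fun _ _ => Fintype.expect_equiv e _ _ fun _ => rfl

section Amplify
variable {p : ℕ} [NeZero p]

/-- Coordinatewise differences of Boolean vectors, scaled by `c`. -/
def boolDiff {ι : Type*} (c : ZMod p) (z : (ι → Bool) × (ι → Bool)) : ι → ZMod p :=
  fun i => c * ((if z.1 i then 1 else 0) - (if z.2 i then 1 else 0))

lemma exists_boxForm_pow_le (p : ℕ) [NeZero p] (j : ℕ) :
    ∃ (T : Type) (_ : Fintype T) (_ : Nonempty T) (τ : T → ZMod p),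
      (∀ m : ℤ, |m| ≤ 2 ^ j → ∃ t, τ t = m) ∧
      ∀ (ι X : Type) [Fintype ι] [DecidableEq ι] [Fintype X] (f : (ι → ZMod p) → ℝ), (∀ u, |f u| ≤ 1) →
        ∀ (c : ZMod p) (a : X → ι → ZMod p),
          |boxForm f a (boolDiff (ι := ι) c)| ^ 2 ^ j ≤
            |boxForm f a (fun (y : ι → T) i => c * τ (y i))| := by
  classical
  induction j with
  | zero =>
    refine ⟨Bool × Bool, inferInstance, inferInstance,
      fun t => (if t.1 then 1 else 0) - (if t.2 then 1 else 0), ?_, ?_⟩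
    · intro m hm
      rw [pow_zero, abs_le] at hm
      obtain ⟨h1, h2⟩ := hm
      interval_cases m
      · exact ⟨(false, true), by simp⟩
      · exact ⟨(false, false), by simp⟩
      · exact ⟨(true, false), by simp⟩
    · intro ι X _ _ _ f hf c a
      rw [pow_zero, pow_one]
      exact (congrArg abs (boxForm_comp_equiv f a (boolDiff c)
        (Equiv.arrowProdEquivProdArrow ι (fun _ => Bool) fun _ => Bool))).ge
  | succ j ih =>
    obtain ⟨T, _, _, τ, hτ, h⟩ := ih
    refine ⟨T × T, inferInstance, inferInstance, fun t => τ t.2 - τ t.1, ?_, ?_⟩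
    · intro m hm
      obtain ⟨m₁, m₂, h₁, h₂, rfl⟩ : ∃ m₁ m₂ : ℤ, |m₁| ≤ 2 ^ j ∧ |m₂| ≤ 2 ^ j ∧ m = m₁ - m₂ := by
        rw [pow_succ] at hm
        have : (0 : ℤ) ≤ 2 ^ j := by positivity
        simp only [abs_le] at hm ⊢
        rcases le_total m 0 with h0 | h0
        · by_cases h1 : - 2 ^ j ≤ m
          · exact ⟨m, 0, by omega, by omega, by omega⟩
          · exact ⟨- 2 ^ j, - 2 ^ j - m, by omega, by omega, by omega⟩
        · by_cases h1 : m ≤ 2 ^ j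
          · exact ⟨m, 0, by omega, by omega, by omega⟩
          · exact ⟨2 ^ j, 2 ^ j - m, by omega, by omega, by omega⟩
      obtain ⟨t₁, ht₁⟩ := hτ m₁ h₁
      obtain ⟨t₂, ht₂⟩ := hτ m₂ h₂
      exact ⟨(t₂, t₁), by simp [ht₁, ht₂]⟩
    · intro ι X _ _ _ f hf c a
      rw [pow_succ, pow_mul]
      refine (pow_le_pow_left₀ (by positivity) (h ι X f hf c a) 2).trans ?_
      rw [sq_abs]
      refine (boxForm_sq_le hf _ _).trans ((le_abs_self _).trans_eq ?_)
      rw [← boxForm_comp_equiv f a _ (Equiv.arrowProdEquivProdArrow ι (fun _ => T) fun _ => T)]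
      congr 2
      ext y i
      simp [mul_sub, Equiv.arrowProdEquivProdArrow]

lemma exists_pow_apForm_le (p : ℕ) (hp : p.Prime) (hp2 : p ≠ 2) [NeZero p] :
    ∃ (k : ℕ) (Ω : Type) (_ : Fintype Ω) (_ : Nonempty Ω) (π : Ω → ZMod p × ZMod p),
      Function.Surjective π ∧
      ∀ (ι : Type) [Fintype ι] [DecidableEq ι] (f g h : (ι → ZMod p) → ℝ),
        (∀ u, |f u| ≤ 1) → (∀ u, |g u| ≤ 1) → (∀ u, |h u| ≤ 1) →
          |apForm f g h (fun (s : ι → Bool) i => if s i then 1 else 0)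
            (fun (s : ι → Bool) i => if s i then 1 else 0)| ^ (4 * k) ≤
            |𝔼 S : ι → Ω, 𝔼 u, f u * f (u + fun i => (π (S i)).1) * f (u + fun i => (π (S i)).2) *
              f (u + (fun i => (π (S i)).1) + fun i => (π (S i)).2)| := by
  obtain ⟨T, _, _, τ, hτ, h⟩ := exists_boxForm_pow_le p p
  have hs : Function.Surjective τ := fun x => by
    obtain ⟨t, ht⟩ := hτ x.val (by
      rw [Nat.abs_cast]
      exact_mod_cast (ZMod.val_lt x).le.trans Nat.lt_two_pow_self.le)
    exact ⟨t, by simpa using ht⟩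
  have : Fact p.Prime := ⟨hp⟩
  have h2 : (2 : ZMod p) ≠ 0 := by
    have : ((2 : ℕ) : ZMod p) ≠ 0 := by
      rw [Ne, ZMod.natCast_eq_zero_iff]
      exact fun hd => hp2 ((Nat.prime_dvd_prime_iff_eq hp Nat.prime_two).1 hd)
    exact_mod_cast this
  refine ⟨2 ^ p * 2 ^ p, T × T, inferInstance, inferInstance, fun t => (2 * τ t.1, 1 * τ t.2),
    ?_, ?_⟩
  · rintro ⟨x, y⟩
    obtain ⟨s, hs'⟩ := hs (2⁻¹ * x)
    obtain ⟨t, ht⟩ := hs y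
    exact ⟨(s, t), by simp [hs', ht, h2]⟩
  · intro ι _ _ f g k hf hg hk
    have h1 := apForm_pow_four_le (f := f) hg hk (fun (s : ι → Bool) i => if s i then 1 else 0)
      (fun (s : ι → Bool) i => if s i then 1 else 0)
    have e1 : (fun z : (ι → Bool) × (ι → Bool) => 2 • ((fun i => if z.1 i then 1 else 0) -
        fun i => if z.2 i then (1 : ZMod p) else 0)) = boolDiff 2 := by
      ext z i; simp [boolDiff]
    have e2 : (fun z : (ι → Bool) × (ι → Bool) => ((fun i => if z.1 i then 1 else 0) -
        fun i => if z.2 i then (1 : ZMod p) else 0)) = boolDiff 1 := by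
      ext z i; simp [boolDiff]
    rw [e1, e2] at h1
    have h3 := h ι _ f hf 1 (boolDiff (ι := ι) 2)
    rw [boxForm_comm f (boolDiff 2) fun (y : ι → T) i => 1 * τ (y i)] at h3
    have h4 := h ι _ f hf 2 (fun (y : ι → T) i => 1 * τ (y i))
    rw [pow_mul, pow_mul, ← abs_pow]
    rw [abs_of_nonneg (Even.pow_nonneg (by decide) _)]
    refine (pow_le_pow_left₀ (by positivity)
      ((pow_le_pow_left₀ (Even.pow_nonneg (by decide) _) (h1.trans (le_abs_self _)) _).trans h3)
        _).trans (h4.trans_eq ?_)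
    rw [boxForm_comm]
    congr 1
    unfold boxForm
    refine (expect_prod_type fun z : (ι → T) × (ι → T) => 𝔼 u, f u * f (u + fun i => 2 * τ (z.1 i)) *
      f (u + fun i => 1 * τ (z.2 i)) *
      f ((u + fun i => 2 * τ (z.1 i)) + fun i => 1 * τ (z.2 i))).symm.trans ?_
    exact (Fintype.expect_equiv (Equiv.arrowProdEquivProdArrow ι (fun _ => T) fun _ => T) _ _
      fun _ => rfl).symm

end Amplify

lemma expect_mul_expect_mul_expect {G : Type*} [Fintype G] (A B C : G → ℂ) (c : ℂ) :
    (𝔼 u, A u) * (𝔼 v, B v) * (𝔼 w, C w) * c = 𝔼 u, 𝔼 v, 𝔼 w, A u * B v * C w * c := by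
  rw [mul_assoc, mul_assoc, expect_mul]
  refine expect_congr rfl fun u _ => ?_
  rw [expect_mul, mul_expect]
  refine expect_congr rfl fun v _ => ?_
  rw [expect_mul, mul_expect, mul_expect]
  refine expect_congr rfl fun w _ => ?_
  ring

section Fourier
variable {G : Type*} [AddCommGroup G] [Fintype G]

lemma fourier_inversion (f : G → ℂ) (x : G) :
    ∑ ψ : AddChar G ℂ, (𝔼 u, f u * ψ u) * ψ (-x) = f x := by
  classical
  simp only [expect_mul]
  rw [← expect_sum_comm]
  have : ∀ u, ∑ ψ : AddChar G ℂ, f u * ψ u * ψ (-x) =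
      if u = x then f x * Fintype.card G else 0 := by
    intro u
    simp only [mul_assoc, ← mul_sum, ← AddChar.map_add_eq_mul]
    rw [AddChar.sum_apply_eq_ite]
    split_ifs with h1 h2 h2
    · rw [h2]
    · exact absurd (by simpa using eq_neg_of_add_eq_zero_left h1) h2
    · exact absurd (by simp [h2]) h1
    · simp
  simp only [this]
  rw [Fintype.expect_eq_sum_div_card]
  simp

lemma sum_norm_sq_fourier (f : G → ℝ) :
    ∑ ψ : AddChar G ℂ, ‖𝔼 u, (f u : ℂ) * ψ (-u)‖ ^ 2 = 𝔼 u, f u ^ 2 := by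
  have h : ∀ ψ : AddChar G ℂ, ((‖𝔼 u, (f u : ℂ) * ψ (-u)‖ ^ 2 : ℝ) : ℂ) =
      𝔼 u, (f u : ℂ) * ((𝔼 v, (f v : ℂ) * ψ v) * ψ (-u)) := by
    intro ψ
    rw [← Complex.normSq_eq_norm_sq, ← Complex.mul_conj, map_expect]
    simp only [map_mul, Complex.conj_ofReal, ← AddChar.map_neg_eq_conj, neg_neg]
    rw [expect_mul]
    exact expect_congr rfl fun u _ => by ring
  apply Complex.ofReal_injective
  rw [Complex.ofReal_sum]
  simp only [h]
  rw [← expect_sum_comm]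
  simp only [← mul_sum]
  simp only [fourier_inversion (fun u => (f u : ℂ))]
  rw [Complex.ofReal_expect]
  exact expect_congr rfl fun u _ => by push_cast; ring

lemma abs_expect_parallelogram_le [Nonempty G] {f₁ f₂ f₃ f₄ : G → ℝ} {M : ℝ}
    (h₂ : ∀ u, |f₂ u| ≤ 1) (h₃ : ∀ u, |f₃ u| ≤ 1) (h₄ : ∀ u, |f₄ u| ≤ 1)
    (hM : ∀ ψ : AddChar G ℂ, ‖𝔼 u, (f₁ u : ℂ) * ψ u‖ ≤ M) :
    |𝔼 u, 𝔼 v, 𝔼 w, f₁ u * f₂ (u + v) * f₃ (u + w) * f₄ (u + v + w)| ≤ M := by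
  have hM0 : 0 ≤ M := (norm_nonneg _).trans (hM 0)
  have h1 : ((𝔼 u, 𝔼 v, 𝔼 w, f₁ u * f₂ (u + v) * f₃ (u + w) * f₄ (u + v + w) : ℝ) : ℂ) =
      ∑ ψ : AddChar G ℂ, (𝔼 u, (f₁ u : ℂ) * ψ u) * (𝔼 u, (f₂ u : ℂ) * ψ (-u)) *
        (𝔼 u, (f₃ u : ℂ) * ψ (-u)) * (𝔼 u, (f₄ u : ℂ) * ψ u) := by
    have hinv := fourier_inversion (fun u => (f₄ u : ℂ))
    generalize hc : (fun ψ : AddChar G ℂ => 𝔼 u, (f₄ u : ℂ) * ψ u) = c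
    simp only [show ∀ ψ : AddChar G ℂ, 𝔼 u, (f₄ u : ℂ) * ψ u = c ψ from congrFun hc] at hinv ⊢
    simp only [expect_mul_expect_mul_expect, ← expect_sum_comm, Complex.ofReal_expect]
    refine expect_congr rfl fun u _ => ?_
    symm
    rw [← expect_add_right_shift _ u]
    refine expect_congr rfl fun v _ => ?_
    rw [← expect_add_right_shift _ u]
    refine expect_congr rfl fun w _ => ?_
    push_cast
    rw [← hinv (u + v + w), mul_sum]
    refine sum_congr rfl fun ψ _ => ?_
    rw [show -(u + v + w) = u + (-(u + v) + -(u + w)) by abel, AddChar.map_add_eq_mul,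
      AddChar.map_add_eq_mul, add_comm v u, add_comm w u]
    ring
  have hle : ∀ ψ : AddChar G ℂ, ‖𝔼 u, (f₄ u : ℂ) * ψ u‖ ≤ 1 := fun ψ => by
    refine (RCLike.norm_expect_le (K := ℂ)).trans (expect_le univ_nonempty fun u _ => ?_)
    rw [norm_mul, AddChar.norm_apply, mul_one, Complex.norm_real]
    exact h₄ u
  have hpars : ∀ f : G → ℝ, (∀ u, |f u| ≤ 1) →
      ∑ ψ : AddChar G ℂ, ‖𝔼 u, (f u : ℂ) * ψ (-u)‖ ^ 2 ≤ 1 := fun f hf => by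
    rw [sum_norm_sq_fourier]
    exact expect_le univ_nonempty fun u _ => (sq_le_one_iff_abs_le_one _).2 (hf u)
  rw [← Real.norm_eq_abs, ← Complex.norm_real, h1]
  calc _ ≤ ∑ ψ : AddChar G ℂ, M * ((‖𝔼 u, (f₂ u : ℂ) * ψ (-u)‖ ^ 2 +
        ‖𝔼 u, (f₃ u : ℂ) * ψ (-u)‖ ^ 2) / 2) := by
        refine (norm_sum_le _ _).trans (sum_le_sum fun ψ _ => ?_)
        rw [norm_mul, norm_mul, norm_mul, mul_assoc ‖_‖]
        refine (mul_le_of_le_one_right (by positivity) (hle ψ)).trans ?_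
        refine mul_le_mul (hM ψ) ?_ (by positivity) hM0
        linarith [two_mul_le_add_sq ‖𝔼 u, (f₂ u : ℂ) * ψ (-u)‖ ‖𝔼 u, (f₃ u : ℂ) * ψ (-u)‖]
    _ ≤ M := by
        rw [← mul_sum, ← sum_div, sum_add_distrib]
        refine mul_le_of_le_one_right hM0 ?_
        linarith [hpars f₂ h₂, hpars f₃ h₃]

end Fourier

section Resample
variable {ι Ω V : Type*} [Fintype ι] [DecidableEq ι] [Fintype Ω] [DecidableEq Ω] [Fintype V]

lemma expect_resample [Nonempty V] {π : Ω → V} {σ : V → Ω} (h : Function.LeftInverse π σ)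
    (Φ : (ι → Ω) → ℝ) :
    𝔼 S, Φ S =
      𝔼 S : ι → Ω, 𝔼 v : ι → V, Φ fun i => if S i = σ (π (S i)) then σ (v i) else S i := by
  let θ : (ι → Ω) × (ι → V) → (ι → Ω) × (ι → V) := fun z =>
    (fun i => if z.1 i = σ (π (z.1 i)) then σ (z.2 i) else z.1 i,
      fun i => if z.1 i = σ (π (z.1 i)) then π (z.1 i) else z.2 i)
  have hθ : Function.Involutive θ := by
    intro z
    ext i
    · by_cases hi : z.1 i = σ (π (z.1 i))
      · simp [θ, h (z.2 i), ← hi]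
      · simp [θ, if_neg hi]
    · by_cases hi : z.1 i = σ (π (z.1 i))
      · simp [θ, if_pos hi, h (z.2 i)]
      · simp [θ, if_neg hi]
  calc 𝔼 S, Φ S = 𝔼 z : (ι → Ω) × (ι → V), Φ z.1 := by
        rw [expect_prod_type]
        exact expect_congr rfl fun S _ => (Fintype.expect_const _).symm
    _ = 𝔼 z : (ι → Ω) × (ι → V), Φ (θ z).1 :=
        (Fintype.expect_equiv hθ.toPerm _ _ fun _ => rfl).symm
    _ = _ := by rw [expect_prod_type]

/-- The set of coordinates at which `S` lies in the image of the section `σ` of `π`. -/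
def sectionCoords (π : Ω → V) (σ : V → Ω) (S : ι → Ω) : Finset ι :=
  univ.filter fun i => S i = σ (π (S i))

omit [Fintype V] in
lemma exists_expect_card_sectionCoords_lt_le [Nonempty V] [Nonempty Ω] {π : Ω → V} {σ : V → Ω}
    (h : Function.LeftInverse π σ) :
    ∃ θ : ℝ, 0 < θ ∧ θ < 1 ∧ ∀ (ι : Type) [Fintype ι] [DecidableEq ι] (K : ℕ),
      (𝔼 S : ι → Ω, if (sectionCoords π σ S).card < K then (1 : ℝ) else 0) ≤
        2 ^ K * θ ^ Fintype.card ι := by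
  let g : Ω → ℝ := fun ω => if ω = σ (π ω) then 1 / 2 else 1
  have hg0 : ∀ ω, 0 < g ω := fun ω => by dsimp only [g]; split_ifs <;> norm_num
  refine ⟨𝔼 ω, g ω, expect_pos (fun ω _ => hg0 ω) univ_nonempty, ?_, ?_⟩
  · refine expect_lt (fun ω _ => ?_) ⟨σ (Classical.arbitrary V), mem_univ _, ?_⟩
    · dsimp only [g]; split_ifs <;> norm_num
    · simp only [g, h _, if_true]; norm_num
  · intro ι _ _ K
    have h1 : (𝔼 ω, g ω) ^ Fintype.card ι = 𝔼 S : ι → Ω, ∏ i, g (S i) := by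
      rw [Fintype.expect_eq_sum_div_card, Fintype.expect_eq_sum_div_card, div_pow,
        Fintype.card_fun, ← Fintype.piFinset_univ, ← prod_univ_sum, prod_const, card_univ]
      push_cast
      rfl
    rw [h1, mul_expect]
    refine expect_le_expect fun S _ => ?_
    have h2 : ∏ i, g (S i) = (1 / 2) ^ (sectionCoords π σ S).card := by
      simp [g, prod_ite, sectionCoords]
    rw [h2]
    split_ifs with hK
    · rw [one_div, inv_pow, ← div_eq_mul_inv, one_le_div (by positivity)]
      exact pow_le_pow_right₀ one_le_two hK.le
    · positivity

end Resample

lemma addChar_map_sum {G M X : Type*} [AddCommMonoid G] [CommMonoid M] (ψ : AddChar G M)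
    (s : Finset X) (F : X → G) : ψ (∑ x ∈ s, F x) = ∏ x ∈ s, ψ (F x) := by
  classical
  induction s using Finset.induction_on with
  | empty => simp
  | insert x s hx ih => rw [sum_insert hx, prod_insert hx, AddChar.map_add_eq_mul, ih]

section Blocks
variable {ι : Type*} [Fintype ι] [DecidableEq ι] {p m : ℕ} [NeZero p]

/-- The embedding of a cube of dimension `m` given by `m` disjoint blocks of `p` coordinates. -/
noncomputable def blockMap (e : Fin m × Fin p ↪ ι) (c : Fin m → ZMod p) : ι → ZMod p :=
  Function.extend e (fun z => c z.1) 0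

omit [Fintype ι] [DecidableEq ι] [NeZero p] in
lemma blockMap_apply (e : Fin m × Fin p ↪ ι) (c : Fin m → ZMod p) (z : Fin m × Fin p) :
    blockMap e c (e z) = c z.1 :=
  e.injective.extend_apply _ _ _

omit [Fintype ι] [DecidableEq ι] [NeZero p] in
lemma blockMap_apply_of_notMem (e : Fin m × Fin p ↪ ι) (c : Fin m → ZMod p) {i : ι}
    (hi : ¬∃ z, e z = i) : blockMap e c i = 0 :=
  Function.extend_apply' _ _ _ hi

omit [Fintype ι] [DecidableEq ι] [NeZero p] in
lemma blockMap_add (e : Fin m × Fin p ↪ ι) (c d : Fin m → ZMod p) :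
    blockMap e (c + d) = blockMap e c + blockMap e d := by
  ext i
  by_cases hi : ∃ z, e z = i
  · obtain ⟨z, rfl⟩ := hi
    simp [blockMap_apply]
  · simp [blockMap_apply_of_notMem _ _ hi]

omit [Fintype ι] in
lemma blockMap_eq_sum (e : Fin m × Fin p ↪ ι) (c : Fin m → ZMod p) :
    blockMap e c = ∑ z, (c z.1).val • Pi.single (e z) 1 := by
  ext i
  rw [Finset.sum_apply]
  by_cases hi : ∃ z, e z = i
  · obtain ⟨z, rfl⟩ := hi
    rw [blockMap_apply, Fintype.sum_eq_single z]
    · simp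
    · intro w hw
      simp [hw.symm]
  · rw [blockMap_apply_of_notMem _ _ hi]
    symm
    refine sum_eq_zero fun z _ => ?_
    have : i ≠ e z := fun h => hi ⟨z, h.symm⟩
    simp [this]

omit [Fintype ι] in
lemma addChar_blockMap (ψ : AddChar (ι → ZMod p) ℂ) (e : Fin m × Fin p ↪ ι)
    {ζ : ℂ} (hζ : ζ ^ p = 1) (h : ∀ z, ψ (Pi.single (e z) 1) = ζ) (c : Fin m → ZMod p) :
    ψ (blockMap e c) = 1 := by
  rw [blockMap_eq_sum, addChar_map_sum]
  simp only [AddChar.map_nsmul_eq_pow, h]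
  rw [Fintype.prod_prod_type]
  refine prod_eq_one fun j _ => ?_
  change ∏ _k : Fin p, ζ ^ (c j).val = 1
  rw [prod_const, card_univ, Fintype.card_fin, ← pow_mul, mul_comm, pow_mul, hζ, one_pow]

omit [Fintype ι] in
lemma exists_embedding_addChar_eq (ψ : AddChar (ι → ZMod p) ℂ) {I : Finset ι}
    (hI : p * (p * m) ≤ I.card) :
    ∃ e : Fin m × Fin p ↪ ι, (∀ z, e z ∈ I) ∧ ∀ c, ψ (blockMap e c) = 1 := by
  have hp : 0 < p := NeZero.pos p
  have hroot : ∀ i, ψ (Pi.single i 1) ^ p = 1 := fun i => by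
    rw [← AddChar.map_nsmul_eq_pow]
    have : (p • Pi.single i 1 : ι → ZMod p) = 0 := by ext j; simp
    rw [this, AddChar.map_zero_eq_one]
  have hcard : (Polynomial.nthRootsFinset p (1 : ℂ)).card ≤ p :=
    (Multiset.toFinset_card_le _).trans (Polynomial.card_nthRoots p 1)
  obtain ⟨ζ, hζ, hle⟩ := exists_le_card_fiber_of_mul_le_card_of_maps_to
    (s := I) (t := Polynomial.nthRootsFinset p (1 : ℂ)) (n := p * m)
    (f := fun i => ψ (Pi.single i 1))
    (fun i _ => (Polynomial.mem_nthRootsFinset hp _).2 (hroot i))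
    ⟨1, (Polynomial.mem_nthRootsFinset hp _).2 (one_pow p)⟩
    ((Nat.mul_le_mul_right _ hcard).trans hI)
  obtain ⟨e⟩ : Nonempty (Fin m × Fin p ↪ {i // i ∈ I.filter fun i => ψ (Pi.single i 1) = ζ}) :=
    Function.Embedding.nonempty_of_card_le (by
      rw [Fintype.card_coe, Fintype.card_prod, Fintype.card_fin, Fintype.card_fin, mul_comm]
      exact hle)
  have hmem := fun z => mem_filter.1 (e z).2
  exact ⟨e.trans (Function.Embedding.subtype _), fun z => (hmem z).1,
    addChar_blockMap ψ _ ((Polynomial.mem_nthRootsFinset hp _).1 hζ) fun z => (hmem z).2⟩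

/-- The coordinate projection keeping the coordinates in `I`. -/
def mask (I : Finset ι) (v : ι → ZMod p) : ι → ZMod p := fun i => if i ∈ I then v i else 0

omit [Fintype ι] [NeZero p] in
lemma mask_add (I : Finset ι) (v w : ι → ZMod p) : mask I (v + w) = mask I v + mask I w := by
  ext i
  by_cases hi : i ∈ I <;> simp [mask, hi]

omit [Fintype ι] [NeZero p] in
lemma mask_blockMap {I : Finset ι} {e : Fin m × Fin p ↪ ι} (he : ∀ z, e z ∈ I)
    (c : Fin m → ZMod p) : mask I (blockMap e c) = blockMap e c := by
  ext i
  by_cases hi : ∃ z, e z = i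
  · obtain ⟨z, rfl⟩ := hi
    simp [mask, he]
  · simp [mask, blockMap_apply_of_notMem _ _ hi]

lemma norm_expect_mask_mul_addChar_le {f : (ι → ZMod p) → ℝ} {η : ℝ} (hη0 : 0 ≤ η)
    (hη : ∀ u (e : Fin m × Fin p ↪ ι), 𝔼 c, f (u + blockMap e c) ≤ η) {I : Finset ι}
    (hI : p * (p * m) ≤ I.card) (u : ι → ZMod p) (ψ : AddChar (ι → ZMod p) ℂ) :
    ‖𝔼 w, (f (u + mask I w) : ℂ) * ψ w‖ ≤ 2 * η - 𝔼 w, f (u + mask I w) := by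
  obtain ⟨e, heI, he⟩ := exists_embedding_addChar_eq ψ hI
  have hshift : ∀ w c, u + mask I (w + blockMap e c) = u + mask I w + blockMap e c := by
    intro w c
    rw [mask_add, mask_blockMap heI, add_assoc]
  have h1 : 𝔼 w, (f (u + mask I w) : ℂ) * ψ w =
      𝔼 w, ((𝔼 c, f (u + mask I w + blockMap e c) : ℝ) : ℂ) * ψ w := by
    simp only [Complex.ofReal_expect, expect_mul]
    rw [expect_comm, ← Fintype.expect_const (ι := Fin m → ZMod p)
      (𝔼 w, (f (u + mask I w) : ℂ) * ψ w)]
    refine expect_congr rfl fun c _ => ?_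
    rw [← expect_add_right_shift _ (blockMap e c)]
    refine expect_congr rfl fun w _ => ?_
    rw [hshift, AddChar.map_add_eq_mul, he, mul_one]
  have h2 : 𝔼 w, f (u + mask I w) = 𝔼 w, 𝔼 c, f (u + mask I w + blockMap e c) := by
    rw [expect_comm, ← Fintype.expect_const (ι := Fin m → ZMod p) (𝔼 w, f (u + mask I w))]
    refine expect_congr rfl fun c _ => ?_
    rw [← expect_add_right_shift _ (blockMap e c)]
    exact expect_congr rfl fun w _ => by rw [hshift]
  rw [h1, h2, ← Fintype.expect_const (ι := ι → ZMod p) (2 * η), ← expect_sub_distrib]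
  refine (RCLike.norm_expect_le (K := ℂ)).trans (expect_le_expect fun w _ => ?_)
  rw [norm_mul, AddChar.norm_apply, mul_one, Complex.norm_real, Real.norm_eq_abs, abs_le]
  have := hη (u + mask I w) e
  constructor <;> linarith

end Blocks

section Increment
variable {ι Ω : Type*} [Fintype ι] [DecidableEq ι] [Fintype Ω] [DecidableEq Ω] {p m : ℕ}
  [NeZero p]

lemma abs_expect_parallelogram_le_of_blocks {π : Ω → ZMod p × ZMod p}
    {σ : ZMod p × ZMod p → Ω} (h : Function.LeftInverse π σ) {f : (ι → ZMod p) → ℝ}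
    (hf : ∀ u, |f u| ≤ 1) (hf0 : 𝔼 u, f u = 0) {η : ℝ} (hη0 : 0 ≤ η)
    (hη : ∀ u (e : Fin m × Fin p ↪ ι), 𝔼 c, f (u + blockMap e c) ≤ η) :
    |𝔼 S : ι → Ω, 𝔼 u, f u * f (u + fun i => (π (S i)).1) * f (u + fun i => (π (S i)).2) *
        f (u + (fun i => (π (S i)).1) + fun i => (π (S i)).2)| ≤
      2 * η + 𝔼 S : ι → Ω, if (sectionCoords π σ S).card < p * (p * m) then (1 : ℝ) else 0 := by
  have : Nonempty Ω := ⟨σ 0⟩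
  have hmul : ∀ a b c d, |f a * f b * f c * f d| ≤ 1 := fun a b c d => by
    rw [abs_mul, abs_mul, abs_mul]
    exact mul_le_one₀ (mul_le_one₀ (mul_le_one₀ (hf _) (abs_nonneg _) (hf _)) (abs_nonneg _)
      (hf _)) (abs_nonneg _) (hf _)
  rw [expect_resample h (fun S => 𝔼 u, f u * f (u + fun i => (π (S i)).1) *
    f (u + fun i => (π (S i)).2) * f (u + (fun i => (π (S i)).1) + fun i => (π (S i)).2)),
    ← Fintype.expect_const (ι := ι → Ω) (2 * η), ← expect_add_distrib]
  refine (abs_expect_le _ _).trans (expect_le_expect fun S _ => ?_)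
  split_ifs with hS
  · refine (abs_expect_le_of_le fun v => abs_expect_le_of_le fun u => hmul _ _ _ _).trans ?_
    linarith
  rw [add_zero]
  set I := sectionCoords π σ S with hI
  let d : ι → ZMod p := fun i => if i ∈ I then 0 else (π (S i)).1
  let e : ι → ZMod p := fun i => if i ∈ I then 0 else (π (S i)).2
  have key : (𝔼 v : ι → ZMod p × ZMod p, 𝔼 u,
      f u * f (u + fun i => (π (if S i = σ (π (S i)) then σ (v i) else S i)).1) *
      f (u + fun i => (π (if S i = σ (π (S i)) then σ (v i) else S i)).2) *
      f (u + (fun i => (π (if S i = σ (π (S i)) then σ (v i) else S i)).1) +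
        fun i => (π (if S i = σ (π (S i)) then σ (v i) else S i)).2)) =
      𝔼 u, 𝔼 x, 𝔼 v, 𝔼 w, f (u + mask I x) * f (u + d + mask I (x + v)) *
        f (u + e + mask I (x + w)) * f (u + d + e + mask I (x + v + w)) := by
    rw [expect_comm (s := (univ : Finset (ι → ZMod p)))]
    conv_lhs => rw [← Fintype.expect_const (ι := ι → ZMod p) (𝔼 v, _)]
    refine expect_congr rfl fun x _ => ?_
    conv_rhs => rw [expect_comm]
    refine (Fintype.expect_equiv
      (Equiv.arrowProdEquivProdArrow ι (fun _ => ZMod p) fun _ => ZMod p) _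
      (fun z : (ι → ZMod p) × (ι → ZMod p) => 𝔼 u, f u * f (u + (d + mask I z.1)) *
        f (u + (e + mask I z.2)) * f (u + (d + mask I z.1) + (e + mask I z.2)))
      fun v => ?_).trans ?_
    · have h1 : (fun i => (π (if S i = σ (π (S i)) then σ (v i) else S i)).1) =
          d + mask I fun i => (v i).1 := by
        ext i
        by_cases hi : S i = σ (π (S i))
        · have hiI : i ∈ I := mem_filter.2 ⟨mem_univ _, hi⟩
          simp [d, mask, hiI, if_pos hi, h (v i)]
        · have hiI : i ∉ I := fun hc => hi (mem_filter.1 hc).2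
          simp [d, mask, hiI, if_neg hi]
      have h2 : (fun i => (π (if S i = σ (π (S i)) then σ (v i) else S i)).2) =
          e + mask I fun i => (v i).2 := by
        ext i
        by_cases hi : S i = σ (π (S i))
        · have hiI : i ∈ I := mem_filter.2 ⟨mem_univ _, hi⟩
          simp [e, mask, hiI, if_pos hi, h (v i)]
        · have hiI : i ∉ I := fun hc => hi (mem_filter.1 hc).2
          simp [e, mask, hiI, if_neg hi]
      rw [h1, h2]
      rfl
    rw [expect_prod_type]
    refine expect_congr rfl fun v _ => ?_
    conv_rhs => rw [expect_comm]
    refine expect_congr rfl fun w _ => ?_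
    rw [← expect_add_right_shift _ (mask I x)]
    refine expect_congr rfl fun u _ => ?_
    simp only [mask_add]
    rw [show u + mask I x + (d + mask I v) = u + d + (mask I x + mask I v) by abel,
      show u + mask I x + (e + mask I w) = u + e + (mask I x + mask I w) by abel,
      show u + d + (mask I x + mask I v) + (e + mask I w) =
        u + d + e + (mask I x + mask I v + mask I w) by abel]
  rw [key]
  have hmean : 𝔼 u, 𝔼 w, f (u + mask I w) = 0 := by
    rw [expect_comm]
    exact expect_eq_zero fun w _ => by rw [expect_add_right_shift, hf0]
  calc _ ≤ 𝔼 u, (2 * η - 𝔼 w, f (u + mask I w)) :=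
        (abs_expect_le _ _).trans <| expect_le_expect fun u _ =>
          abs_expect_parallelogram_le (f₁ := fun x => f (u + mask I x))
            (f₂ := fun x => f (u + d + mask I x)) (f₃ := fun x => f (u + e + mask I x))
            (f₄ := fun x => f (u + d + e + mask I x)) (fun _ => hf _) (fun _ => hf _)
            (fun _ => hf _) fun ψ => norm_expect_mask_mul_addChar_le hη0 hη (not_lt.1 hS) u ψ
    _ = 2 * η := by rw [expect_sub_distrib, hmean, sub_zero, Fintype.expect_const]

end Increment

section Density
variable {p : ℕ} [NeZero p]

/-- `f` is the indicator function of a set without nontrivial restricted 3-APs. -/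
structure IsRestrictedFree {ι : Type*} (f : (ι → ZMod p) → ℝ) : Prop where
  zero_or_one : ∀ x, f x = 0 ∨ f x = 1
  free : ∀ x a : ι → ZMod p, (∀ i, a i = 0 ∨ a i = 1 ∨ a i = 2) → a ≠ 0 →
    f x = 1 → f (x + a) = 1 → f (x + 2 • a) ≠ 1

namespace IsRestrictedFree
variable {ι : Type*} {f : (ι → ZMod p) → ℝ}

omit [NeZero p] in
lemma nonneg (hf : IsRestrictedFree f) (x : ι → ZMod p) : 0 ≤ f x := by
  rcases hf.zero_or_one x with h | h <;> rw [h]; exact zero_le_one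

omit [NeZero p] in
lemma le_one (hf : IsRestrictedFree f) (x : ι → ZMod p) : f x ≤ 1 := by
  rcases hf.zero_or_one x with h | h <;> rw [h]; exact zero_le_one

omit [NeZero p] in
lemma abs_le_one (hf : IsRestrictedFree f) (x : ι → ZMod p) : |f x| ≤ 1 := by
  rw [abs_of_nonneg (hf.nonneg x)]; exact hf.le_one x

lemma blockMap {m : ℕ} (hf : IsRestrictedFree f) (u : ι → ZMod p) (e : Fin m × Fin p ↪ ι) :
    IsRestrictedFree fun c => f (u + blockMap e c) where
  zero_or_one c := hf.zero_or_one _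
  free x a ha ha0 h0 h1 := by
    rw [two_smul, blockMap_add, blockMap_add, ← two_smul ℕ, ← add_assoc]
    rw [blockMap_add, ← add_assoc] at h1
    refine hf.free _ _ (fun i => ?_) (fun h => ha0 ?_) h0 h1
    · by_cases hi : ∃ z, e z = i
      · obtain ⟨z, rfl⟩ := hi
        rw [blockMap_apply]
        exact ha _
      · exact Or.inl (blockMap_apply_of_notMem _ _ hi)
    · ext j
      have := congrFun h (e (j, ⟨0, NeZero.pos p⟩))
      rwa [blockMap_apply] at this

variable [Fintype ι] [DecidableEq ι]

lemma apForm_le (hp2 : p ≠ 2) (hp1 : p ≠ 1) (hf : IsRestrictedFree f) :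
    apForm f f f (fun (s : ι → Bool) i => if s i then 1 else 0)
      (fun (s : ι → Bool) i => if s i then 1 else 0) ≤ (1 / 4) ^ Fintype.card ι := by
  have h0 : 2 < p := by have := NeZero.pos p; omega
  have hone : (1 : ZMod p) ≠ 0 := by
    have : ((1 : ℕ) : ZMod p) ≠ 0 := by
      rw [Ne, ZMod.natCast_eq_zero_iff]
      exact fun hd => absurd (Nat.le_of_dvd one_pos hd) (by omega)
    exact_mod_cast this
  have htwo : (1 + 1 : ZMod p) ≠ 0 := by
    have : ((2 : ℕ) : ZMod p) ≠ 0 := by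
      rw [Ne, ZMod.natCast_eq_zero_iff]
      exact fun hd => absurd (Nat.le_of_dvd two_pos hd) (by omega)
    rw [one_add_one_eq_two]
    exact_mod_cast this
  calc _ ≤ 𝔼 s : ι → Bool, 𝔼 t : ι → Bool,
        (if s = fun _ => false then (1 : ℝ) else 0) * if t = fun _ => false then 1 else 0 := by
        refine expect_le_expect fun s _ => expect_le_expect fun t _ => ?_
        split_ifs with hs ht ht
        · rw [mul_one]
          refine expect_le univ_nonempty fun x _ => ?_
          exact mul_le_one₀ (mul_le_one₀ (hf.le_one _) (hf.nonneg _) (hf.le_one _))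
            (hf.nonneg _) (hf.le_one _)
        all_goals
          refine (expect_eq_zero fun x _ => ?_).le.trans_eq (by simp)
          by_contra hne
          have h1 := (hf.zero_or_one _).resolve_left (left_ne_zero_of_mul (left_ne_zero_of_mul hne))
          have h2 := (hf.zero_or_one _).resolve_left (right_ne_zero_of_mul (left_ne_zero_of_mul hne))
          have h3 := (hf.zero_or_one _).resolve_left (right_ne_zero_of_mul hne)
          refine hf.free _ _ (fun i => ?_) (fun h => ?_) h1 h2 h3
          · cases hsi : s i <;> cases hti : t i <;> simp [hsi, hti, one_add_one_eq_two]
          · have hi : ∀ i, s i = false ∧ t i = false := fun i => by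
              have := congrFun h i
              cases hsi : s i <;> cases hti : t i <;>
                simp [hsi, hti, hone] at this ⊢
              exact htwo this
            first
            | exact hs (funext fun i => (hi i).1)
            | exact ht (funext fun i => (hi i).2)
    _ = _ := by
      rw [← expect_mul_expect, Fintype.expect_eq_sum_div_card, sum_ite_eq' univ]
      simp only [mem_univ, if_true, Fintype.card_fun, Fintype.card_bool]
      push_cast
      rw [div_mul_div_comm, ← mul_pow, div_pow]
      norm_num

lemma cube_le (hp2 : p ≠ 2) (hp1 : p ≠ 1) (hf : IsRestrictedFree f) {α : ℝ}
    (hα : 𝔼 x, f x = α) :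
    α ^ 3 ≤ (1 / 4) ^ Fintype.card ι +
      |apForm (fun x => f x - α) f f (fun (s : ι → Bool) i => if s i then 1 else 0)
        (fun (s : ι → Bool) i => if s i then 1 else 0)| +
      |apForm (fun x => f x - α) f 1 (fun (s : ι → Bool) i => if s i then 1 else 0)
        (fun (s : ι → Bool) i => if s i then 1 else 0)| := by
  have h := hf.apForm_le hp2 hp1
  generalize (fun (s : ι → Bool) i => if s i then (1 : ZMod p) else 0) = a at h ⊢
  have h0 : 0 ≤ α := hα ▸ expect_nonneg fun x _ => hf.nonneg x
  have h1 : α ≤ 1 := hα ▸ expect_le univ_nonempty fun x _ => hf.le_one x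
  have e1 : apForm f f f a a = apForm (fun x => f x - α) f f a a + α * apForm f f 1 a a := by
    unfold apForm
    simp only [mul_expect, ← expect_add_distrib]
    refine expect_congr rfl fun s _ => expect_congr rfl fun t _ => ?_
    rw [expect_add_distrib, ← expect_add_right_shift (fun x => α * _) (a s + a t),
      ← expect_add_distrib]
    refine expect_congr rfl fun x _ => ?_
    rw [two_smul, ← add_assoc]
    simp only [Pi.one_apply]
    ring_nf
  have e2 : apForm f f 1 a a = apForm (fun x => f x - α) f 1 a a + α * α := by
    have : α * α = apForm (fun _ => α) f 1 a a := by
      unfold apForm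
      simp only [Pi.one_apply, mul_one, ← mul_expect, expect_add_right_shift, hα,
        Fintype.expect_const]
    rw [this]
    unfold apForm
    simp only [← expect_add_distrib]
    refine expect_congr rfl fun s _ => expect_congr rfl fun t _ => expect_congr rfl fun x _ => ?_
    ring
  have h3 : -(α * apForm (fun x => f x - α) f 1 a a) ≤ |apForm (fun x => f x - α) f 1 a a| := by
    rw [← mul_neg]
    exact (mul_le_mul_of_nonneg_left (neg_le_abs _) h0).trans
      (mul_le_of_le_one_left (abs_nonneg _) h1)
  have h4 := neg_le_abs (apForm (fun x => f x - α) f f a a)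
  rw [e1, e2] at h
  linarith [h, h3, h4, show α ^ 3 = α * (α * α) by ring,
    mul_add α (apForm (fun x => f x - α) f 1 a a) (α * α)]

end IsRestrictedFree

lemma exists_pow_lt_mul_pow {ρ : ℝ} (h0 : 0 ≤ ρ) (h1 : ρ < 1) (K : ℕ) {c : ℝ} (hc : 0 < c) :
    ∃ D : ℝ, 0 < D ∧ ∀ α : ℝ, 0 < α → α ≤ 1 → ∀ n : ℕ, D / α ≤ n → ρ ^ n < c * α ^ K := by
  have ht := tendsto_pow_const_mul_const_pow_of_lt_one K h0 h1
  obtain ⟨N, hN⟩ := Filter.eventually_atTop.1 (ht.eventually (gt_mem_nhds hc))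
  refine ⟨N + 1, by positivity, fun α hα hα1 n hn => ?_⟩
  have hn1 : (N + 1 : ℝ) ≤ n := (le_div_self (by positivity) hα hα1).trans hn
  have hNn : N ≤ n := by
    have : (N : ℝ) ≤ n := by linarith
    exact_mod_cast this
  have hαn : 1 ≤ α * n := by
    rw [div_le_iff₀ hα] at hn
    have : (0 : ℝ) ≤ N := N.cast_nonneg
    linarith
  have hpow : 1 ≤ α ^ K * (n : ℝ) ^ K := by rw [← mul_pow]; exact one_le_pow₀ hαn
  calc ρ ^ n ≤ (α ^ K * (n : ℝ) ^ K) * ρ ^ n := le_mul_of_one_le_left (pow_nonneg h0 n) hpow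
    _ = α ^ K * ((n : ℝ) ^ K * ρ ^ n) := by ring
    _ < α ^ K * c := mul_lt_mul_of_pos_left (hN n hNn) (by positivity)
    _ = c * α ^ K := mul_comm _ _

lemma exists_density_increment (hp : p.Prime) (hp2 : p ≠ 2) :
    ∃ (K : ℕ) (c D : ℝ), 0 < c ∧ c ≤ 1 ∧ 0 < D ∧
      ∀ (n : ℕ) (f : (Fin n → ZMod p) → ℝ) (α : ℝ), IsRestrictedFree f → 0 < α →
        α ≤ 𝔼 x, f x → D / α ≤ n →
        ∃ (m : ℕ) (g : (Fin m → ZMod p) → ℝ), IsRestrictedFree g ∧ c * n ≤ m ∧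
          α + c * α ^ K ≤ 𝔼 x, g x := by
  classical
  obtain ⟨k, Ω, _, _, π, hπ, hk⟩ := exists_pow_apForm_le p hp hp2
  have hσ : Function.LeftInverse π (Function.surjInv hπ) := Function.surjInv_eq hπ
  obtain ⟨θ, hθ0, hθ1, hθ⟩ := exists_expect_card_sectionCoords_lt_le hσ
  have hs0 : 0 < √θ := Real.sqrt_pos.2 hθ0
  have hs1 : √θ < 1 := by rw [Real.sqrt_lt' one_pos]; simpa
  obtain ⟨R, hR⟩ := exists_pow_lt_of_lt_one (show (0 : ℝ) < (2 ^ (p * p))⁻¹ by positivity) hs1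
  obtain ⟨D₁, hD₁, h₁⟩ := exists_pow_lt_mul_pow hs0.le hs1 (3 * (4 * k))
    (show (0 : ℝ) < (1 / 3) ^ (4 * k) / 2 by positivity)
  obtain ⟨D₂, hD₂, h₂⟩ := exists_pow_lt_mul_pow (show (0 : ℝ) ≤ 1 / 4 by norm_num)
    (by norm_num) 3 (show (0 : ℝ) < 1 / 3 by norm_num)
  have hRpos : 0 < R := by
    rcases Nat.eq_zero_or_pos R with rfl | h
    · rw [pow_zero] at hR
      exact absurd hR (not_lt.2 (inv_le_one_of_one_le₀ (one_le_pow₀ one_le_two)))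
    · exact h
  have hR1 : (1 : ℝ) ≤ R := by exact_mod_cast hRpos
  set c₁ : ℝ := (1 / 3) ^ (4 * k) / 4 with hc₁
  have hc₁0 : 0 < c₁ := by positivity
  refine ⟨3 * (4 * k), min c₁ (1 / (2 * R)), D₁ + D₂ + R, by positivity, ?_, by positivity, ?_⟩
  · refine (min_le_right _ _).trans ?_
    rw [div_le_one (by positivity)]
    linarith
  intro n f α' hf hα' hmean hn
  obtain ⟨α, hα⟩ : ∃ α, 𝔼 x, f x = α := ⟨_, rfl⟩
  rw [hα] at hmean
  have hα0 : 0 < α := hα'.trans_le hmean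
  have hα1 : α ≤ 1 := hα ▸ expect_le univ_nonempty fun x _ => hf.le_one x
  have hDα : (D₁ + D₂ + R) / α ≤ n := (div_le_div_of_nonneg_left (by positivity) hα' hmean).trans hn
  have hn₁ : D₁ / α ≤ n := (div_le_div_of_nonneg_right (by linarith) hα0.le).trans hDα
  have hn₂ : D₂ / α ≤ n := (div_le_div_of_nonneg_right (by linarith) hα0.le).trans hDα
  have hnR : (R : ℝ) ≤ n := (le_div_self (by positivity) hα0 hα1).trans
    ((div_le_div_of_nonneg_right (by linarith) hα0.le).trans hDα)
  have hRn : R ≤ n := by exact_mod_cast hnR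
  by_contra hcon
  set m := n / R with hm
  have hblock : ∀ u (e : Fin m × Fin p ↪ Fin n),
      𝔼 c, (f (u + blockMap e c) - α) ≤ c₁ * α ^ (3 * (4 * k)) := by
    intro u e
    by_contra! hlt
    rw [expect_sub_distrib, Fintype.expect_const] at hlt
    refine hcon ⟨m, _, hf.blockMap u e, ?_, ?_⟩
    · have h3 : n < R * (m + 1) := Nat.lt_mul_div_succ n hRpos
      have h4 : 1 ≤ m := Nat.div_pos hRn hRpos
      have h5 : n ≤ 2 * R * m := by nlinarith
      have h6 : (n : ℝ) ≤ 2 * R * m := by exact_mod_cast h5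
      calc min c₁ (1 / (2 * R)) * n ≤ 1 / (2 * R) * n := by gcongr; exact min_le_right _ _
        _ ≤ m := by rw [one_div_mul_eq_div, div_le_iff₀ (by positivity)]; linarith
    · have : min c₁ (1 / (2 * R)) * α' ^ (3 * (4 * k)) ≤ c₁ * α ^ (3 * (4 * k)) := by
        gcongr
        exact min_le_left _ _
      linarith
  have hfa : ∀ u, |f u - α| ≤ 1 := fun u => by
    rw [abs_le]
    constructor <;> linarith [hf.nonneg u, hf.le_one u]
  have hf0 : 𝔼 u, (f u - α) = 0 := by
    rw [expect_sub_distrib, Fintype.expect_const, hα, sub_self]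
  have hbound := (abs_expect_parallelogram_le_of_blocks hσ hfa hf0 (by positivity) hblock).trans
    (add_le_add_right (hθ (Fin n) (p * (p * m))) _)
  have hsmall : 2 ^ (p * (p * m)) * θ ^ Fintype.card (Fin n) ≤ √θ ^ n := by
    rw [Fintype.card_fin]
    calc (2 : ℝ) ^ (p * (p * m)) * θ ^ n = (2 ^ (p * p)) ^ m * √θ ^ n * √θ ^ n := by
          rw [mul_assoc ((2 ^ (p * p)) ^ m), ← mul_pow, Real.mul_self_sqrt hθ0.le, ← pow_mul,
            mul_assoc]
      _ ≤ (2 ^ (p * p)) ^ m * √θ ^ (R * m) * √θ ^ n := by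
          gcongr ?_ * ?_ * ?_
          exact pow_le_pow_of_le_one hs0.le hs1.le (Nat.mul_div_le n R)
      _ = (2 ^ (p * p) * √θ ^ R) ^ m * √θ ^ n := by rw [mul_pow, ← pow_mul (√θ)]
      _ ≤ √θ ^ n := by
          refine mul_le_of_le_one_left (by positivity) (pow_le_one₀ (by positivity) ?_)
          calc (2 : ℝ) ^ (p * p) * √θ ^ R ≤ 2 ^ (p * p) * (2 ^ (p * p))⁻¹ := by gcongr
            _ = 1 := mul_inv_cancel₀ (by positivity)
  have hfin : ∀ x : ℝ, x ^ (4 * k) ≤ 2 * (c₁ * α ^ (3 * (4 * k))) +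
      2 ^ (p * (p * m)) * θ ^ Fintype.card (Fin n) → x < α ^ 3 / 3 := by
    intro x hx
    by_contra! hx'
    have h3 := pow_le_pow_left₀ (by positivity) hx' (4 * k)
    have h4 := h₁ α hα0 hα1 n hn₁
    have h5 : (α ^ 3 / 3) ^ (4 * k) = 4 * (c₁ * α ^ (3 * (4 * k))) := by
      rw [hc₁, div_eq_mul_one_div, mul_pow, ← pow_mul]; ring
    have h6 : (1 / 3 : ℝ) ^ (4 * k) / 2 = 2 * c₁ := by rw [hc₁]; ring
    rw [h6] at h4
    linarith
  have hA := hfin _ ((hk (Fin n) _ f f hfa hf.abs_le_one hf.abs_le_one).trans hbound)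
  have hB := hfin _ ((hk (Fin n) _ f 1 hfa hf.abs_le_one (by simp)).trans hbound)
  have hC := hf.cube_le hp2 hp.ne_one hα
  have hD := h₂ α hα0 hα1 n hn₂
  rw [Fintype.card_fin] at hC
  linarith

lemma add_mul_le_one_of_isRestrictedFree {K : ℕ} {c D : ℝ} (hc : 0 < c) (hc1 : c ≤ 1)
    (hD : 0 < D)
    (h : ∀ (n : ℕ) (f : (Fin n → ZMod p) → ℝ) (α : ℝ), IsRestrictedFree f → 0 < α →
        α ≤ 𝔼 x, f x → D / α ≤ n →
        ∃ (m : ℕ) (g : (Fin m → ZMod p) → ℝ), IsRestrictedFree g ∧ c * n ≤ m ∧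
          α + c * α ^ K ≤ 𝔼 x, g x) {α : ℝ} (hα : 0 < α) (T n : ℕ)
    (f : (Fin n → ZMod p) → ℝ) (hf : IsRestrictedFree f) (γ : ℝ) (hαγ : α ≤ γ)
    (hγ : γ ≤ 𝔼 x, f x) (hn : D / α ≤ c ^ T * n) : γ + T * (c * α ^ K) ≤ 1 := by
  induction T generalizing n f γ with
  | zero =>
    have := expect_le (s := univ) (f := f) univ_nonempty fun x _ => hf.le_one x
    simpa using hγ.trans this
  | succ T ih =>
    have hn' : D / γ ≤ n := (div_le_div_of_nonneg_left hD.le hα hαγ).trans <| hn.trans <|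
      mul_le_of_le_one_left n.cast_nonneg (pow_le_one₀ hc.le hc1)
    obtain ⟨m, g, hg, hm, hmean⟩ := h n f γ hf (hα.trans_le hαγ) hγ hn'
    have hpow : c * α ^ K ≤ c * γ ^ K := by gcongr
    have := ih m g hg (γ + c * α ^ K) (by have : 0 ≤ c * α ^ K := by positivity
                                          linarith) (by linarith) (hn.trans (by
      rw [pow_succ, mul_assoc]
      gcongr))
    push_cast
    linarith

end Density

lemma le_exp_exp_exp {L D α : ℝ} (K : ℕ) (hL : 1 ≤ L) (hD : 0 < D) (hα : 0 < α) (hα1 : α ≤ 1) :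
    D / α * L ^ ⌈L / α ^ K⌉₊ ≤ Real.exp (Real.exp (Real.exp
      ((K + 1 + 2 * L ^ 2 + D) / α ^ (K + 1 + 2 * L ^ 2 + D : ℝ)))) := by
  set C : ℝ := K + 1 + 2 * L ^ 2 + D with hC
  have hαK : α ^ K ≤ 1 := pow_le_one₀ hα.le hα1
  have hpos : 0 < α ^ K := by positivity
  have h1 : (⌈L / α ^ K⌉₊ : ℝ) ≤ 2 * L / α ^ K := by
    have h2 := (Nat.ceil_lt_add_one (show 0 ≤ L / α ^ K by positivity)).le
    have h3 : 1 ≤ L / α ^ K := by rw [one_le_div hpos]; linarith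
    rw [mul_div_assoc]
    linarith
  have h4 : α ^ C ≤ α ^ (K + 1) := by
    rw [← Real.rpow_natCast]
    refine Real.rpow_le_rpow_of_exponent_ge hα hα1 ?_
    push_cast
    rw [hC]
    nlinarith
  have h5 : α ^ C ≤ α ^ K := h4.trans (by rw [pow_succ]; exact mul_le_of_le_one_right hpos.le hα1)
  have h6 : α ^ C ≤ α := h4.trans (by rw [pow_succ]; exact mul_le_of_le_one_left hα.le hαK)
  have hαC : 0 < α ^ C := Real.rpow_pos_of_pos hα C
  have hself : ∀ x : ℝ, x ≤ Real.exp x := fun x => by linarith [Real.add_one_le_exp x]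
  calc D / α * L ^ ⌈L / α ^ K⌉₊ ≤ Real.exp (D / α) * Real.exp L ^ ⌈L / α ^ K⌉₊ := by
        gcongr
        · exact hself _
        · exact hself _
    _ = Real.exp (D / α + ⌈L / α ^ K⌉₊ * L) := by rw [← Real.exp_nat_mul, ← Real.exp_add]
    _ ≤ Real.exp (C / α ^ C) := by
        rw [Real.exp_le_exp]
        calc D / α + ⌈L / α ^ K⌉₊ * L ≤ D / α + 2 * L / α ^ K * L := by gcongr
          _ = D / α + 2 * L ^ 2 / α ^ K := by ring
          _ ≤ D / α ^ C + 2 * L ^ 2 / α ^ C := by gcongr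
          _ = (D + 2 * L ^ 2) / α ^ C := by ring
          _ ≤ C / α ^ C := by
            gcongr
            rw [hC]
            have : (0 : ℝ) ≤ K := K.cast_nonneg
            linarith
    _ ≤ Real.exp (Real.exp (Real.exp (C / α ^ C))) := by
        rw [Real.exp_le_exp]
        exact (hself _).trans (hself _)

lemma exists_restricted_threeAP_two {α : ℝ} {n : ℕ} (hα : 0 < α)
    (hn : 1 / α ≤ n) {f : (Fin n → ZMod 2) → ℝ} (hf : ∀ x, f x = 0 ∨ f x = 1)
    (hmean : α ≤ (∑ x, f x) / 2 ^ n) :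
    ∃ x a : Fin n → ZMod 2, (∀ i, a i = 0 ∨ a i = 1 ∨ a i = 2) ∧ a ≠ 0 ∧
      f x = 1 ∧ f (x + a) = 1 ∧ f (x + 2 • a) = 1 := by
  have hsum : 1 < ∑ x, f x := by
    rw [le_div_iff₀ (by positivity)] at hmean
    rw [div_le_iff₀ hα] at hn
    have h2 : (n : ℝ) < 2 ^ n := by exact_mod_cast Nat.lt_two_pow_self
    nlinarith
  have hcard : 1 < (univ.filter fun x => f x = 1).card := by
    have : ∑ x, f x = (univ.filter fun x => f x = 1).card := by
      rw [← sum_boole]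
      refine sum_congr rfl fun x _ => ?_
      rcases hf x with h | h <;> simp [h]
    rw [this] at hsum
    exact_mod_cast hsum
  obtain ⟨x, hx, y, hy, hxy⟩ := one_lt_card.1 hcard
  have hall : ∀ z : ZMod 2, z = 0 ∨ z = 1 ∨ z = 2 := by decide
  have hdouble : 2 • (y - x) = 0 := by
    ext i
    simp only [Pi.smul_apply, Pi.zero_apply]
    generalize (y - x) i = z
    revert z
    decide
  refine ⟨x, y - x, fun i => hall _, sub_ne_zero.2 hxy.symm, (mem_filter.1 hx).2, ?_, ?_⟩
  · rw [add_sub_cancel]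
    exact (mem_filter.1 hy).2
  · rw [hdouble, add_zero]
    exact (mem_filter.1 hx).2

/-- **Main theorem, restated.** For every prime `p` there is `C = C(p) > 0` such that for every
`α ∈ (0,1]`, if `n ≥ exp(exp(exp(C/α^C)))` and `f : 𝔽_p^n → {0,1}` has average at least `α`,
then `f` contains a restricted 3-AP: points `x, x+a, x+2a` with `a ∈ {0,1,2}^n \ {0}` on which
`f` equals `1`. -/
theorem restricted_threeAP_exists_of_dense (p : ℕ) (hp : p.Prime) [NeZero p] :
    ∃ C : ℝ, 0 < C ∧
      ∀ α : ℝ, 0 < α → α ≤ 1 →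
        ∀ n : ℕ, (n : ℝ) ≥ Real.exp (Real.exp (Real.exp (C / α ^ C))) →
          ∀ f : (Fin n → ZMod p) → ℝ, (∀ x, f x = 0 ∨ f x = 1) →
            (∑ x, f x) / (p : ℝ) ^ n ≥ α →
            ∃ x a : Fin n → ZMod p, (∀ i, a i = 0 ∨ a i = 1 ∨ a i = 2) ∧ a ≠ 0 ∧
              f x = 1 ∧ f (x + a) = 1 ∧ f (x + 2 • a) = 1 := by
  rcases eq_or_ne p 2 with rfl | hp2
  · refine ⟨1, one_pos, fun α hα _ n hn f hf hmean => ?_⟩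
    have hself : ∀ x : ℝ, x ≤ Real.exp x := fun x => by linarith [Real.add_one_le_exp x]
    rw [Real.rpow_one] at hn
    exact exists_restricted_threeAP_two hα
      (((hself _).trans ((hself _).trans (hself _))).trans hn) hf (by exact_mod_cast hmean)
  · obtain ⟨K, c, D, hc, hc1, hD, hstep⟩ := exists_density_increment hp hp2
    have hL : 1 ≤ 1 / c := by rwa [one_le_div hc]
    refine ⟨K + 1 + 2 * (1 / c) ^ 2 + D, by positivity, fun α hα hα1 n hn f hf hmean => ?_⟩
    by_contra hcon
    have hfree : IsRestrictedFree f :=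
      ⟨hf, fun x a ha ha0 h0 h1 h2 => hcon ⟨x, a, ha, ha0, h0, h1, h2⟩⟩
    have hmean' : α ≤ 𝔼 x, f x := by
      rw [Fintype.expect_eq_sum_div_card, Fintype.card_fun, ZMod.card, Fintype.card_fin]
      exact_mod_cast hmean
    set T := ⌈1 / c / α ^ K⌉₊ with hT
    have hnT : D / α ≤ c ^ T * n := by
      have h1 := (le_exp_exp_exp K hL hD hα hα1).trans hn
      rw [← hT, one_div, inv_pow, ← div_eq_mul_inv, div_le_iff₀ (by positivity)] at h1
      linarith
    have h2 := add_mul_le_one_of_isRestrictedFree hc hc1 hD hstep hα T n f hfree α le_rfl hmean' hnT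
    have h3 : 1 ≤ T * (c * α ^ K) := by
      rw [← div_le_iff₀ (by positivity), ← div_div]
      exact Nat.le_ceil _
    linarith
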